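/- For every finite bipartite graph G=(A,B,E), ker_A(G) ∪ ker_B(G) = ker(G). -/

import Mathlib

open Finset

open scoped Classical

variable {V : Type*} [Fintype V] [DecidableEq V]

/-- The neighborhood `N(X)` of a finite set of vertices `X`. -/
noncomputable def nbr (G : SimpleGraph V) (X : Finset V) : Finset V :=
  Finset.univ.filter fun v => ∃ x ∈ X, G.Adj v x

/-- The difference `d(X) = |X| - |N(X)|` of a set of vertices. -/
noncomputable def diffZ (G : SimpleGraph V) (X : Finset V) : ℤ :=
  (X.card : ℤ) - ((nbr G X).card : ℤ)

/-- The critical difference `d_c(G) = max {d(X) : X ⊆ V}`. -/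
noncomputable def critDiff (G : SimpleGraph V) : ℤ :=
  (Finset.univ : Finset V).powerset.sup' (Finset.powerset_nonempty _) (diffZ G)

/-- A set of vertices is independent if no two of its vertices are adjacent. -/
def IsIndep (G : SimpleGraph V) (S : Finset V) : Prop :=
  ∀ u ∈ S, ∀ v ∈ S, ¬ G.Adj u v

/-- The independence number `α(G)`. -/
noncomputable def indepNum (G : SimpleGraph V) : ℕ :=
  ((Finset.univ : Finset V).powerset.filter (IsIndep G)).sup Finset.card

/-- The critical independence difference `id_c(G) = max {d(I) : I independent}`. -/
noncomputable def idc (G : SimpleGraph V) : ℤ :=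
  ((Finset.univ : Finset V).powerset.filter (IsIndep G)).sup'
    ⟨∅, by simp [IsIndep]⟩ (diffZ G)

/-- A critical independent set: an independent set `S` with `d(S) = id_c(G)`. -/
def CritIndep (G : SimpleGraph V) (S : Finset V) : Prop :=
  IsIndep G S ∧ diffZ G S = idc G

/-- A finite set of edges of `G` that are pairwise non-incident (a matching). -/
def IsMatchingSet (G : SimpleGraph V) (M : Finset (Sym2 V)) : Prop :=
  (∀ e ∈ M, e ∈ G.edgeSet) ∧
    (M : Set (Sym2 V)).Pairwise fun e f => ∀ v : V, ¬(v ∈ e ∧ v ∈ f)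

/-- The matching number `μ(G)`. -/
noncomputable def matchNum (G : SimpleGraph V) : ℕ :=
  ((Finset.univ : Finset (Sym2 V)).powerset.filter (IsMatchingSet G)).sup Finset.card

/-- A maximum independent set. -/
def IsMaxIndep (G : SimpleGraph V) (S : Finset V) : Prop :=
  IsIndep G S ∧ S.card = indepNum G

/-- `ker(G)`: the intersection of all critical independent sets. -/
noncomputable def kerSet (G : SimpleGraph V) : Finset V :=
  Finset.univ.filter fun v => ∀ S : Finset V, CritIndep G S → v ∈ S

/-- `diadem(G)`: the union of all critical independent sets. -/
noncomputable def diademSet (G : SimpleGraph V) : Finset V :=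
  Finset.univ.filter fun v => ∃ S : Finset V, CritIndep G S ∧ v ∈ S

/-- `core(G)`: the intersection of all maximum independent sets. -/
noncomputable def coreSet (G : SimpleGraph V) : Finset V :=
  Finset.univ.filter fun v => ∀ S : Finset V, IsMaxIndep G S → v ∈ S

/-- `corona(G)`: the union of all maximum independent sets. -/
noncomputable def coronaSet (G : SimpleGraph V) : Finset V :=
  Finset.univ.filter fun v => ∃ S : Finset V, IsMaxIndep G S ∧ v ∈ S

/-- `δ₀(A) = max {δ(X) : X ⊆ A}`, the maximum deficiency over subsets of a side. -/
noncomputable def delta0 (G : SimpleGraph V) (A : Finset V) : ℤ :=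
  A.powerset.sup' (Finset.powerset_nonempty _) (diffZ G)

/-- An `A`-critical set: a subset `X ⊆ A` with `δ(X) = δ₀(A)`. -/
def SideCrit (G : SimpleGraph V) (A X : Finset V) : Prop :=
  X ⊆ A ∧ diffZ G X = delta0 G A

/-- `ker_A(G)`: the intersection of all `A`-critical sets. -/
noncomputable def kerSide (G : SimpleGraph V) (A : Finset V) : Finset V :=
  Finset.univ.filter fun v => ∀ X : Finset V, SideCrit G A X → v ∈ X

/-- `diadem_A(G)`: the union of all `A`-critical sets. -/
noncomputable def diademSide (G : SimpleGraph V) (A : Finset V) : Finset V :=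
  Finset.univ.filter fun v => ∃ X : Finset V, SideCrit G A X ∧ v ∈ X

/-- `{A, B}` is a bipartition of `G`: both sides nonempty, disjoint, covering all
vertices, and every edge goes between `A` and `B`. -/
def IsBipartition (G : SimpleGraph V) (A B : Finset V) : Prop :=
  A.Nonempty ∧ B.Nonempty ∧ Disjoint A B ∧ A ∪ B = Finset.univ ∧
    ∀ u v : V, G.Adj u v → (u ∈ A ∧ v ∈ B) ∨ (u ∈ B ∧ v ∈ A)

theorem IsBipartition.symm {G : SimpleGraph V} {A B : Finset V} (h : IsBipartition G A B) :
    IsBipartition G B A :=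
  ⟨h.2.1, h.1, h.2.2.1.symm, by rw [union_comm]; exact h.2.2.2.1,
    fun u v huv => (h.2.2.2.2 u v huv).symm⟩

theorem mem_nbr {G : SimpleGraph V} {X : Finset V} {v : V} :
    v ∈ nbr G X ↔ ∃ x ∈ X, G.Adj v x := by
  simp [nbr]

theorem nbr_union (G : SimpleGraph V) (X Y : Finset V) :
    nbr G (X ∪ Y) = nbr G X ∪ nbr G Y := by
  ext v
  simp only [mem_nbr, mem_union, or_and_right, exists_or]

/-- The neighborhood of a subset of one side lies in the other side. -/
theorem IsBipartition.nbr_subset {G : SimpleGraph V} {A B X : Finset V}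
    (h : IsBipartition G A B) (hX : X ⊆ A) : nbr G X ⊆ B := by
  intro v hv
  obtain ⟨x, hx, hvx⟩ := mem_nbr.1 hv
  rcases h.2.2.2.2 v x hvx with h' | h'
  · exact absurd h'.2 (Finset.disjoint_left.1 h.2.2.1 (hX hx))
  · exact h'.1

/-- The difference is additive across the two sides of a bipartition. -/
theorem IsBipartition.diffZ_union {G : SimpleGraph V} {A B X Y : Finset V}
    (h : IsBipartition G A B) (hX : X ⊆ A) (hY : Y ⊆ B) :
    diffZ G (X ∪ Y) = diffZ G X + diffZ G Y := by
  have hXY : Disjoint X Y := Finset.disjoint_of_subset_left hX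
    (Finset.disjoint_of_subset_right hY h.2.2.1)
  have hN : Disjoint (nbr G X) (nbr G Y) :=
    Finset.disjoint_of_subset_left (h.nbr_subset hX)
      (Finset.disjoint_of_subset_right (h.symm.nbr_subset hY) h.2.2.1.symm)
  simp only [diffZ, nbr_union, card_union_of_disjoint hXY, card_union_of_disjoint hN]
  push_cast
  ring

theorem IsBipartition.inter_union_inter {G : SimpleGraph V} {A B : Finset V}
    (h : IsBipartition G A B) (S : Finset V) : S ∩ A ∪ S ∩ B = S := by
  rw [← inter_union_distrib_left, h.2.2.2.1, inter_univ]

theorem diffZ_le_delta0 (G : SimpleGraph V) {A X : Finset V} (hX : X ⊆ A) :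
    diffZ G X ≤ delta0 G A :=
  Finset.le_sup' (diffZ G) (mem_powerset.2 hX)

theorem exists_sideCrit (G : SimpleGraph V) (A : Finset V) : ∃ X, SideCrit G A X := by
  obtain ⟨X, hX, h⟩ := Finset.exists_mem_eq_sup' (Finset.powerset_nonempty A) (diffZ G)
  exact ⟨X, mem_powerset.1 hX, h.symm⟩

theorem diffZ_le_idc {G : SimpleGraph V} {S : Finset V} (hS : IsIndep G S) :
    diffZ G S ≤ idc G :=
  Finset.le_sup' (diffZ G) (by simpa using hS)

theorem IsBipartition.idc_le {G : SimpleGraph V} {A B : Finset V} (h : IsBipartition G A B) :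
    idc G ≤ delta0 G A + delta0 G B := by
  refine Finset.sup'_le _ _ fun S _ => ?_
  rw [← h.inter_union_inter S, h.diffZ_union inter_subset_right inter_subset_right]
  exact add_le_add (diffZ_le_delta0 G inter_subset_right) (diffZ_le_delta0 G inter_subset_right)

/-- Removing `N(Y)` from `X` removes `Y ∩ N(X)` from the neighborhood of `X`. -/
theorem le_diffZ_sdiff_nbr (G : SimpleGraph V) (X Y : Finset V) :
    diffZ G X - ((X ∩ nbr G Y).card : ℤ) + ((Y ∩ nbr G X).card : ℤ) ≤
      diffZ G (X \ nbr G Y) := by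
  have hsub : nbr G (X \ nbr G Y) ⊆ nbr G X \ Y := by
    intro v hv
    obtain ⟨x, hx, hvx⟩ := mem_nbr.1 hv
    rw [mem_sdiff] at hx ⊢
    exact ⟨mem_nbr.2 ⟨x, hx.1, hvx⟩, fun hvY => hx.2 (mem_nbr.2 ⟨v, hvY, hvx.symm⟩)⟩
  have hle := card_le_card hsub
  have hX := card_sdiff_add_card_inter X (nbr G Y)
  have hN := card_sdiff_add_card_inter (nbr G X) Y
  rw [inter_comm (nbr G X)] at hN
  simp only [diffZ]
  omega

/-- Any two critical sets of the two sides give a critical independent set after deleting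
from each the neighbors of the other. -/
theorem IsBipartition.critIndep_sdiff_union_sdiff {G : SimpleGraph V} {A B X Y : Finset V}
    (h : IsBipartition G A B) (hX : SideCrit G A X) (hY : SideCrit G B Y) :
    CritIndep G (X \ nbr G Y ∪ Y \ nbr G X) := by
  have hXA : X \ nbr G Y ⊆ A := sdiff_subset.trans hX.1
  have hYB : Y \ nbr G X ⊆ B := sdiff_subset.trans hY.1
  have hind : IsIndep G (X \ nbr G Y ∪ Y \ nbr G X) := by
    intro u hu v hv huv
    have hAB := Finset.disjoint_left.1 h.2.2.1
    simp only [mem_union, mem_sdiff] at hu hv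
    rcases hu with hu | hu <;> rcases hv with hv | hv
    · exact hAB (hX.1 hu.1) (h.nbr_subset hX.1 (mem_nbr.2 ⟨v, hv.1, huv⟩))
    · exact hu.2 (mem_nbr.2 ⟨v, hv.1, huv⟩)
    · exact hu.2 (mem_nbr.2 ⟨v, hv.1, huv⟩)
    · exact hAB (h.symm.nbr_subset hY.1 (mem_nbr.2 ⟨v, hv.1, huv⟩)) (hY.1 hu.1)
  refine ⟨hind, le_antisymm (diffZ_le_idc hind) (h.idc_le.trans ?_)⟩
  rw [h.diffZ_union hXA hYB, ← hX.2, ← hY.2]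
  linarith [le_diffZ_sdiff_nbr G X Y, le_diffZ_sdiff_nbr G Y X]

theorem IsBipartition.idc_eq {G : SimpleGraph V} {A B : Finset V} (h : IsBipartition G A B) :
    idc G = delta0 G A + delta0 G B := by
  obtain ⟨X, hX⟩ := exists_sideCrit G A
  obtain ⟨Y, hY⟩ := exists_sideCrit G B
  refine le_antisymm h.idc_le ?_
  rw [← (h.critIndep_sdiff_union_sdiff hX hY).2,
    h.diffZ_union (sdiff_subset.trans hX.1) (sdiff_subset.trans hY.1), ← hX.2, ← hY.2]
  linarith [le_diffZ_sdiff_nbr G X Y, le_diffZ_sdiff_nbr G Y X]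

theorem IsBipartition.sideCrit_inter {G : SimpleGraph V} {A B S : Finset V}
    (h : IsBipartition G A B) (hS : CritIndep G S) : SideCrit G A (S ∩ A) := by
  refine ⟨inter_subset_right, le_antisymm (diffZ_le_delta0 G inter_subset_right) ?_⟩
  have hsum := h.diffZ_union (X := S ∩ A) (Y := S ∩ B) inter_subset_right inter_subset_right
  rw [h.inter_union_inter, hS.2, h.idc_eq] at hsum
  linarith [diffZ_le_delta0 G (A := B) (X := S ∩ B) inter_subset_right]

theorem IsBipartition.kerSide_subset_kerSet {G : SimpleGraph V} {A B : Finset V}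
    (h : IsBipartition G A B) : kerSide G A ⊆ kerSet G := by
  intro v hv
  simp only [kerSide, kerSet, mem_filter, mem_univ, true_and] at hv ⊢
  exact fun S hS => mem_of_mem_inter_left (hv _ (h.sideCrit_inter hS))

theorem IsBipartition.mem_kerSide_of_mem_kerSet {G : SimpleGraph V} {A B : Finset V} {v : V}
    (h : IsBipartition G A B) (hvA : v ∈ A) (hv : v ∈ kerSet G) : v ∈ kerSide G A := by
  simp only [kerSide, kerSet, mem_filter, mem_univ, true_and] at hv ⊢
  intro X hX
  obtain ⟨Y, hY⟩ := exists_sideCrit G B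
  rcases mem_union.1 (hv _ (h.critIndep_sdiff_union_sdiff hX hY)) with hvX | hvY
  · exact (mem_sdiff.1 hvX).1
  · exact absurd (hY.1 (mem_sdiff.1 hvY).1) (Finset.disjoint_left.1 h.2.2.1 hvA)

/-- For every finite bipartite graph, `ker_A(G) ∪ ker_B(G) = ker(G)`. -/
theorem kerSide_union_kerSide_eq_kerSet (G : SimpleGraph V) (A B : Finset V)
    (hbip : IsBipartition G A B) :
    kerSide G A ∪ kerSide G B = kerSet G := by
  refine Subset.antisymm
    (union_subset hbip.kerSide_subset_kerSet hbip.symm.kerSide_subset_kerSet) fun v hv => ?_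
  have hvAB : v ∈ A ∪ B := hbip.2.2.2.1 ▸ mem_univ v
  rcases mem_union.1 hvAB with hvA | hvB
  · exact mem_union_left _ (hbip.mem_kerSide_of_mem_kerSet hvA hv)
  · exact mem_union_right _ (hbip.symm.mem_kerSide_of_mem_kerSet hvB hv)
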